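/- Let Ω := ℝ × (−1,1) ⊂ ℝ². Then the first Poincaré constant of Ω equals π²/4, i.e. inf { ∫_Ω |∇u(x)|² dx / ∫_Ω u(x)² dx : u ∈ C_c^∞(Ω), u ≢ 0 } = π²/4. -/

import Mathlib

open MeasureTheory Real

/-- The infinite planar strip `Ω = ℝ × (-1,1) ⊂ ℝ²`. -/
def strip : Set (EuclideanSpace ℝ (Fin 2)) := {x | x 1 ∈ Set.Ioo (-1 : ℝ) 1}

/-- `u ∈ C_c^∞(Ω)`: smooth, compactly supported, with support contained in `Ω`. -/
def IsTest (Ω : Set (EuclideanSpace ℝ (Fin 2)))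
    (u : EuclideanSpace ℝ (Fin 2) → ℝ) : Prop :=
  ContDiff ℝ (⊤ : ℕ∞) u ∧ HasCompactSupport u ∧ tsupport u ⊆ Ω

theorem strip_setIntegrals {u : EuclideanSpace ℝ (Fin 2) → ℝ} (hu : IsTest strip u) :
    (∫ x in strip, ‖fderiv ℝ u x‖ ^ 2) = (∫ x, ‖fderiv ℝ u x‖ ^ 2) ∧
    (∫ x in strip, u x ^ 2) = ∫ x, u x ^ 2 := by
  obtain ⟨h1, h2, h3⟩ := hu
  constructor
  · apply setIntegral_eq_integral_of_forall_compl_eq_zero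
    intro x hx
    have : x ∉ tsupport (fderiv ℝ u) := fun h => hx (h3 (tsupport_fderiv_subset ℝ h))
    rw [image_eq_zero_of_notMem_tsupport this]; simp
  · apply setIntegral_eq_integral_of_forall_compl_eq_zero
    intro x hx
    rw [image_eq_zero_of_notMem_tsupport (fun h => hx (h3 h))]; simp

theorem strip_cs_sq {X : Type*} [TopologicalSpace X] {f : X → ℝ} (hc : HasCompactSupport f) :
    HasCompactSupport (fun x => f x ^ 2) := by
  have := hc.comp_left (g := fun t : ℝ => t ^ 2) (by simp)
  exact this

theorem strip_den_pos {u : EuclideanSpace ℝ (Fin 2) → ℝ} (hu : IsTest strip u) (h0 : u ≠ 0) :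
    0 < ∫ x, u x ^ 2 := by
  obtain ⟨x, hx⟩ := Function.ne_iff.1 h0
  have hc : HasCompactSupport (fun x => u x ^ 2) := strip_cs_sq hu.2.1
  exact (hu.1.continuous.pow 2).integral_pos_of_hasCompactSupport_nonneg_nonzero hc
    (fun x => by positivity) (x := x) (by simpa using hx)

theorem strip_integral_deriv_zero {V : EuclideanSpace ℝ (Fin 2) → ℝ}
    (hV : ContDiff ℝ 1 V) (hc : HasCompactSupport V) (e : EuclideanSpace ℝ (Fin 2)) :
    Integrable (fun x => fderiv ℝ V x e) ∧ ∫ x, fderiv ℝ V x e = 0 := by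
  have hcont : Continuous (fun x => fderiv ℝ V x e) :=
    (hV.continuous_fderiv (by norm_num)).clm_apply continuous_const
  have hi : Integrable (fun x => fderiv ℝ V x e) :=
    hcont.integrable_of_hasCompactSupport (hc.fderiv_apply ℝ e)
  refine ⟨hi, ?_⟩
  have := integral_mul_fderiv_eq_neg_fderiv_mul_of_integrable (μ := volume)
    (f := fun _ : EuclideanSpace ℝ (Fin 2) => (1 : ℝ)) (g := V) (v := e)
    (by simp) (by simpa using hi)
    (by simpa using hV.continuous.integrable_of_hasCompactSupport hc)
    (fun x _ => differentiableAt_const _)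
    (fun x _ => hV.differentiable (by norm_num) x)
  simpa using this

theorem strip_lower {u : EuclideanSpace ℝ (Fin 2) → ℝ} (hu : IsTest strip u) :
    Real.pi ^ 2 / 4 * (∫ x, u x ^ 2) ≤ ∫ x, ‖fderiv ℝ u x‖ ^ 2 := by
  obtain ⟨h1, h2, h3⟩ := hu
  set e : EuclideanSpace ℝ (Fin 2) := EuclideanSpace.single 1 1 with he
  have hen : ‖e‖ = 1 := by simp [he]
  set V : EuclideanSpace ℝ (Fin 2) → ℝ := fun x => u x ^ 2 * (π / 2 * tan (π / 2 * x 1)) with hV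
  have hcos : ∀ x ∈ strip, cos (π / 2 * x 1) ≠ 0 := by
    intro x hx
    have hx : -1 < x 1 ∧ x 1 < 1 := hx
    apply ne_of_gt
    apply Real.cos_pos_of_mem_Ioo
    constructor <;> nlinarith [Real.pi_pos]
  have hdu : Differentiable ℝ u := h1.differentiable (by simp)
  have hVs : ContDiff ℝ 1 V := by
    rw [contDiff_iff_contDiffAt]
    intro x
    by_cases hx : x ∈ tsupport u
    · have hproj : ContDiffAt ℝ 1 (fun x : EuclideanSpace ℝ (Fin 2) => π / 2 * x 1) x := by
        fun_prop
      have ht : ContDiffAt ℝ 1 (fun x : EuclideanSpace ℝ (Fin 2) => tan (π / 2 * x 1)) x := by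
        have ht0 : ContDiffAt ℝ 1 tan (π / 2 * x 1) := Real.contDiffAt_tan.2 (hcos x (h3 hx))
        exact ContDiffAt.comp (g := tan) x ht0 hproj
      have hu1 : ContDiffAt ℝ 1 u x := (h1.of_le (by exact_mod_cast le_top)).contDiffAt
      exact (hu1.pow 2).mul (contDiffAt_const.mul ht)
    · have h0 : u =ᶠ[nhds x] 0 := notMem_tsupport_iff_eventuallyEq.1 hx
      have : V =ᶠ[nhds x] fun _ => 0 := by
        filter_upwards [h0] with y hy
        simp [hV, hy]
      exact contDiffAt_const.congr_of_eventuallyEq this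
  have hVc : HasCompactSupport V := by
    exact (strip_cs_sq h2).mul_right
  obtain ⟨hi, hz⟩ := strip_integral_deriv_zero hVs hVc e
  have hiu : Integrable (fun x => u x ^ 2) :=
    (h1.continuous.pow 2).integrable_of_hasCompactSupport (strip_cs_sq h2)
  have hig : Integrable (fun x => ‖fderiv ℝ u x‖ ^ 2) := by
    refine Continuous.integrable_of_hasCompactSupport
      ((h1.continuous_fderiv (by simp)).norm.pow 2) ?_
    exact strip_cs_sq (h2.fderiv ℝ).norm
  have hpt : ∀ x, π ^ 2 / 4 * u x ^ 2 - fderiv ℝ V x e ≤ ‖fderiv ℝ u x‖ ^ 2 := by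
    intro x
    by_cases hx : x ∈ tsupport u
    · have hc := hcos x (h3 hx)
      have hproj : HasFDerivAt (fun x : EuclideanSpace ℝ (Fin 2) => π / 2 * x 1)
          ((π / 2) • (EuclideanSpace.proj 1 : EuclideanSpace ℝ (Fin 2) →L[ℝ] ℝ)) x :=
        ((EuclideanSpace.proj 1 : EuclideanSpace ℝ (Fin 2) →L[ℝ] ℝ).hasFDerivAt).const_mul (π / 2)
      have ht := (Real.hasDerivAt_tan hc).comp_hasFDerivAt x hproj
      have hd := ((hdu x).hasFDerivAt.pow 2).mul (ht.const_mul (π / 2))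
      have hVe : fderiv ℝ V x e = 2 * u x * fderiv ℝ u x e * (π / 2 * tan (π / 2 * x 1))
          + u x ^ 2 * (π ^ 2 / 4 * (1 / cos (π / 2 * x 1) ^ 2)) := by
        have : HasFDerivAt V _ x := hd
        rw [this.fderiv]
        simp [he]
        ring
      have htan : 1 / cos (π / 2 * x 1) ^ 2 = 1 + tan (π / 2 * x 1) ^ 2 := by
        rw [Real.tan_eq_sin_div_cos]
        generalize π / 2 * x 1 = θ at hc
        field_simp
        linarith [Real.sin_sq_add_cos_sq θ]
      have hle : (fderiv ℝ u x e) ^ 2 ≤ ‖fderiv ℝ u x‖ ^ 2 := by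
        have := (fderiv ℝ u x).le_opNorm e
        rw [hen, mul_one, Real.norm_eq_abs] at this
        rw [← sq_abs]
        gcongr
      rw [hVe, htan]
      nlinarith [sq_nonneg (fderiv ℝ u x e + π / 2 * tan (π / 2 * x 1) * u x)]
    · have h0 : u =ᶠ[nhds x] 0 := notMem_tsupport_iff_eventuallyEq.1 hx
      have : V =ᶠ[nhds x] fun _ => 0 := by
        filter_upwards [h0] with y hy
        simp [hV, hy]
      rw [this.fderiv_eq, h0.eq_of_nhds]
      simp
  have := integral_mono ((hiu.const_mul (π ^ 2 / 4)).sub hi) hig hpt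
  simp only [Pi.sub_apply] at this
  rw [integral_sub (hiu.const_mul _) hi, hz, integral_const_mul] at this
  linarith

theorem strip_integral_prod (f g : ℝ → ℝ) :
    ∫ x : EuclideanSpace ℝ (Fin 2), f (x 0) * g (x 1) = (∫ t, f t) * ∫ t, g t := by
  have h := (volume_preserving_finTwoArrow ℝ).comp
    (EuclideanSpace.volume_preserving_symm_measurableEquiv_toLp (Fin 2))
  have h2 := h.integral_comp
    ((MeasurableEquiv.toLp 2 (Fin 2 → ℝ)).symm.trans
      MeasurableEquiv.finTwoArrow).measurableEmbedding (fun p : ℝ × ℝ => f p.1 * g p.2)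
  rw [← integral_prod_mul]
  exact h2

theorem strip_integrable_prod (f g : ℝ → ℝ) (hf : Integrable f) (hg : Integrable g) :
    Integrable (fun x : EuclideanSpace ℝ (Fin 2) => f (x 0) * g (x 1)) := by
  have h := (volume_preserving_finTwoArrow ℝ).comp
    (EuclideanSpace.volume_preserving_symm_measurableEquiv_toLp (Fin 2))
  exact h.integrable_comp_of_integrable (hf.mul_prod hg)

theorem integrable_sq_of_cs {f : ℝ → ℝ} (hf : Continuous f) (hc : HasCompactSupport f) :
    Integrable (fun t => f t ^ 2) :=
  (hf.pow 2).integrable_of_hasCompactSupport (strip_cs_sq hc)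

theorem strip_product {φ ψ : ℝ → ℝ} (hφ : ContDiff ℝ (⊤ : ℕ∞) φ) (hφc : HasCompactSupport φ)
    (hψ : ContDiff ℝ (⊤ : ℕ∞) ψ) (hψc : HasCompactSupport ψ)
    (hψs : tsupport ψ ⊆ Set.Ioo (-1) 1) :
    IsTest strip (fun x => φ (x 0) * ψ (x 1)) ∧
    (∫ x : EuclideanSpace ℝ (Fin 2), (φ (x 0) * ψ (x 1)) ^ 2) = (∫ t, φ t ^ 2) * ∫ t, ψ t ^ 2 ∧
    (∫ x : EuclideanSpace ℝ (Fin 2), ‖fderiv ℝ (fun x : EuclideanSpace ℝ (Fin 2) =>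
      φ (x 0) * ψ (x 1)) x‖ ^ 2) =
      (∫ t, deriv φ t ^ 2) * (∫ t, ψ t ^ 2) + (∫ t, φ t ^ 2) * ∫ t, deriv ψ t ^ 2 := by
  refine ⟨⟨?_, ?_, ?_⟩, ?_, ?_⟩
  · fun_prop
  · have hK : IsCompact ((fun p : ℝ × ℝ => (!₂[p.1, p.2] : EuclideanSpace ℝ (Fin 2))) ''
        (tsupport φ ×ˢ tsupport ψ)) := by
      apply (hφc.isCompact.prod hψc.isCompact).image
      fun_prop
    refine HasCompactSupport.intro hK ?_
    intro x hx
    by_contra hne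
    apply hx
    refine ⟨(x 0, x 1), ⟨?_, ?_⟩, ?_⟩
    · exact subset_tsupport _ (left_ne_zero_of_mul hne)
    · exact subset_tsupport _ (right_ne_zero_of_mul hne)
    · ext i; fin_cases i <;> simp
  · have : tsupport (fun x : EuclideanSpace ℝ (Fin 2) => φ (x 0) * ψ (x 1)) ⊆
        {x | x 1 ∈ tsupport ψ} := by
      apply closure_minimal
      · intro x hx
        exact subset_tsupport _ (right_ne_zero_of_mul hx)
      · exact (isClosed_tsupport ψ).preimage (by fun_prop)
    exact fun x hx => hψs (this hx)
  · simp_rw [mul_pow]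
    exact strip_integral_prod (fun t => φ t ^ 2) (fun t => ψ t ^ 2)
  · have hd : ∀ x : EuclideanSpace ℝ (Fin 2), ‖fderiv ℝ (fun x : EuclideanSpace ℝ (Fin 2) =>
      φ (x 0) * ψ (x 1)) x‖ ^ 2 = deriv φ (x 0) ^ 2 * ψ (x 1) ^ 2 +
        φ (x 0) ^ 2 * deriv ψ (x 1) ^ 2 := by
      intro x
      have h0 := ((hφ.differentiable (by simp)) (x 0)).hasDerivAt.comp_hasFDerivAt x
        (EuclideanSpace.proj 0 : EuclideanSpace ℝ (Fin 2) →L[ℝ] ℝ).hasFDerivAt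
      have h1 := ((hψ.differentiable (by simp)) (x 1)).hasDerivAt.comp_hasFDerivAt x
        (EuclideanSpace.proj 1 : EuclideanSpace ℝ (Fin 2) →L[ℝ] ℝ).hasFDerivAt
      have h : HasFDerivAt (fun x : EuclideanSpace ℝ (Fin 2) => φ (x 0) * ψ (x 1)) _ x := h0.mul h1
      rw [h.fderiv, (EuclideanSpace.basisFun (Fin 2) ℝ).norm_dual]
      simp [Fin.sum_univ_two]
      ring
    simp_rw [hd]
    have c1 : Continuous (deriv φ) := hφ.continuous_deriv (by simp)
    have c2 : Continuous (deriv ψ) := hψ.continuous_deriv (by simp)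
    rw [integral_add]
    · rw [strip_integral_prod (fun t => deriv φ t ^ 2) (fun t => ψ t ^ 2),
        strip_integral_prod (fun t => φ t ^ 2) (fun t => deriv ψ t ^ 2)]
    · exact strip_integrable_prod (fun t => deriv φ t ^ 2) (fun t => ψ t ^ 2)
        (integrable_sq_of_cs c1 hφc.deriv) (integrable_sq_of_cs hψ.continuous hψc)
    · exact strip_integrable_prod (fun t => φ t ^ 2) (fun t => deriv ψ t ^ 2)
        (integrable_sq_of_cs hφ.continuous hφc) (integrable_sq_of_cs c2 hψc.deriv)

/-- Smooth cutoff on `(-1,1)`. -/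
noncomputable def stripCut (N : ℝ) (y : ℝ) : ℝ := smoothTransition ((1 - y ^ 2) * N - 1)

theorem stripCut_contDiff (N : ℝ) : ContDiff ℝ (⊤ : ℕ∞) (stripCut N) := by
  have h : ContDiff ℝ (⊤ : ℕ∞) smoothTransition := smoothTransition.contDiff
  exact h.comp (by fun_prop : ContDiff ℝ (⊤ : ℕ∞) (fun y : ℝ => (1 - y ^ 2) * N - 1))

theorem stripCut_tsupport {N : ℝ} (hN : 0 < N) : tsupport (stripCut N) ⊆ Set.Ioo (-1) 1 := by
  have : tsupport (stripCut N) ⊆ {y | 1 ≤ (1 - y ^ 2) * N} := by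
    apply closure_minimal
    · intro y hy
      by_contra h
      simp only [Set.mem_ofPred_eq, not_le] at h
      exact hy (smoothTransition.zero_of_nonpos (by linarith))
    · exact isClosed_le continuous_const (by fun_prop)
  intro y hy
  have h := this hy
  simp only [Set.mem_ofPred_eq] at h
  have h2 : y ^ 2 < 1 := by
    by_contra h3
    nlinarith
  exact abs_lt.1 ((sq_lt_one_iff_abs_lt_one y).1 h2)

theorem stripCut_cs {N : ℝ} (hN : 0 < N) : HasCompactSupport (stripCut N) :=
  HasCompactSupport.of_support_subset_isCompact (K := Set.Icc (-1) 1) isCompact_Icc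
    ((subset_tsupport _).trans ((stripCut_tsupport hN).trans Set.Ioo_subset_Icc_self))

theorem deriv_smoothTransition_zero {t : ℝ} (ht : t < 0 ∨ 1 < t) :
    deriv smoothTransition t = 0 := by
  rcases ht with ht | ht
  · have : smoothTransition =ᶠ[nhds t] fun _ => 0 := by
      filter_upwards [Iio_mem_nhds ht] with y hy
      exact smoothTransition.zero_of_nonpos (le_of_lt hy)
    rw [this.deriv_eq]; simp
  · have : smoothTransition =ᶠ[nhds t] fun _ => 1 := by
      filter_upwards [Ioi_mem_nhds ht] with y hy
      exact smoothTransition.one_of_one_le (le_of_lt hy)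
    rw [this.deriv_eq]; simp

theorem deriv_smoothTransition_bdd : ∃ C : ℝ, 0 ≤ C ∧ ∀ t, |deriv smoothTransition t| ≤ C := by
  have hc : Continuous (deriv smoothTransition) :=
    (smoothTransition.contDiff (n := 1)).continuous_deriv (by norm_num)
  obtain ⟨C, hC⟩ := (isCompact_Icc (a := (0 : ℝ)) (b := 1)).exists_bound_of_continuousOn
    hc.continuousOn
  have hC0 : 0 ≤ C := (norm_nonneg _).trans (hC 0 (by simp))
  refine ⟨C, hC0, fun t => ?_⟩
  by_cases ht : t ∈ Set.Icc (0 : ℝ) 1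
  · exact hC t ht
  · rw [deriv_smoothTransition_zero, abs_zero]
    · exact hC0
    · by_contra h
      push Not at h
      exact ht h

theorem stripCut_hasDerivAt (N y : ℝ) : HasDerivAt (stripCut N)
    (deriv smoothTransition ((1 - y ^ 2) * N - 1) * (-(2 * y) * N)) y := by
  have h : HasDerivAt (fun y : ℝ => (1 - y ^ 2) * N - 1) (-(2 * y) * N) y := by
    have := ((((hasDerivAt_id y).pow 2).const_sub 1).mul_const N).sub_const 1
    simpa using this
  have h2 : HasDerivAt smoothTransition (deriv smoothTransition ((1 - y ^ 2) * N - 1))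
      ((1 - y ^ 2) * N - 1) :=
    ((smoothTransition.contDiff (n := 1)).differentiable (by norm_num) _).hasDerivAt
  exact h2.comp y h

theorem exists_phi {ε : ℝ} (hε : 0 < ε) : ∃ φ : ℝ → ℝ, ContDiff ℝ (⊤ : ℕ∞) φ ∧
    HasCompactSupport φ ∧ 0 < (∫ t, φ t ^ 2) ∧ (∫ t, deriv φ t ^ 2) ≤ ε * ∫ t, φ t ^ 2 := by
  have hg := stripCut_contDiff 2
  have hc := stripCut_cs (N := 2) (by norm_num)
  set g := stripCut 2 with hgdef
  have hB : 0 < ∫ t, g t ^ 2 :=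
    (hg.continuous.pow 2).integral_pos_of_hasCompactSupport_nonneg_nonzero (strip_cs_sq hc)
      (fun x => by positivity) (x := 0) (by
        have : g 0 = 1 := smoothTransition.one_of_one_le (by norm_num)
        simp [this])
  set A := ∫ t, deriv g t ^ 2 with hA
  have hA0 : 0 ≤ A := integral_nonneg fun t => by positivity
  set B := ∫ t, g t ^ 2 with hBdef
  obtain ⟨R, hR1, hR⟩ : ∃ R : ℝ, 1 ≤ R ∧ A / (ε * B) ≤ R :=
    ⟨max 1 (A / (ε * B)), le_max_left _ _, le_max_right _ _⟩
  have hR0 : 0 < R := by linarith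
  have hAR : A ≤ R * (ε * B) := by
    rwa [div_le_iff₀ (by positivity)] at hR
  have hphi : (∫ t, g (t / R) ^ 2) = R * B := by
    have := Measure.integral_comp_div (fun t => g t ^ 2) R
    rw [this, abs_of_pos hR0, smul_eq_mul]
  refine ⟨fun x => g (x / R), by fun_prop, ?_, ?_, ?_⟩
  · have := hc.comp_homeomorph (Homeomorph.mulRight₀ R⁻¹ (by positivity))
    exact this
  · rw [hphi]; positivity
  · have hd : ∀ t, deriv (fun x => g (x / R)) t = deriv g (t / R) / R := by
      intro t
      have h1 : HasDerivAt (fun x : ℝ => x / R) (1 / R) t := (hasDerivAt_id t).div_const R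
      have h2 := (hg.differentiable (by simp) (t / R)).hasDerivAt
      have h3 : HasDerivAt (fun x => g (x / R)) _ t :=
        HasDerivAt.comp (h₂ := g) (h := fun x : ℝ => x / R) t h2 h1
      rw [h3.deriv]; ring
    simp_rw [hd, hphi, div_pow]
    have := Measure.integral_comp_div (fun t => deriv g t ^ 2) R
    rw [integral_div, this, abs_of_pos hR0, smul_eq_mul, div_le_iff₀ (by positivity)]
    have h1 : A * R ≤ R * (ε * B) * R := by gcongr
    have h2 : R * (ε * B) * R ≤ R * (ε * B) * R * R := le_mul_of_one_le_right (by positivity) hR1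
    calc R * A = A * R := by ring
      _ ≤ R * (ε * B) * R * R := h1.trans h2
      _ = _ := by ring

theorem cos_strip_bound {y : ℝ} (hy : |y| ≤ 1) : |cos (π / 2 * y)| ≤ π / 2 * (1 - y ^ 2) := by
  have h0 := abs_nonneg y
  have hpi := Real.pi_pos
  have h1 : cos (π / 2 * y) = sin (π / 2 * (1 - |y|)) := by
    rw [← Real.cos_abs, abs_mul, abs_of_pos (by positivity : 0 < π / 2),
      ← Real.sin_pi_div_two_sub]
    ring_nf
  have h2 : 0 ≤ π / 2 * (1 - |y|) := by apply mul_nonneg <;> linarith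
  rw [h1, abs_of_nonneg (Real.sin_nonneg_of_nonneg_of_le_pi h2 (by nlinarith))]
  refine (Real.sin_le h2).trans ?_
  gcongr
  rw [← sq_abs]
  nlinarith

theorem psi_identity {N : ℝ} (hN : 0 < N) :
    (∫ y, deriv (fun y => cos (π / 2 * y) * stripCut N y) y ^ 2) =
      π ^ 2 / 4 * (∫ y, (cos (π / 2 * y) * stripCut N y) ^ 2) +
      ∫ y, (cos (π / 2 * y) * deriv (stripCut N) y) ^ 2 := by
  have hg := stripCut_contDiff N
  have hc := stripCut_cs hN
  set g := stripCut N
  have hgd : Continuous (deriv g) := hg.continuous_deriv (by simp)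
  have hdg : ∀ y, HasDerivAt g (deriv g y) y := fun y =>
    (hg.differentiable (by simp) y).hasDerivAt
  have hlin : ∀ y : ℝ, HasDerivAt (fun y => π / 2 * y) (π / 2) y := fun y => by
    simpa using (hasDerivAt_id y).const_mul (π / 2)
  have hcd : ∀ y, HasDerivAt (fun y => cos (π / 2 * y)) (-sin (π / 2 * y) * (π / 2)) y :=
    fun y => (hlin y).cos
  have hsd : ∀ y, HasDerivAt (fun y => sin (π / 2 * y)) (cos (π / 2 * y) * (π / 2)) y :=
    fun y => (hlin y).sin
  have hpsi : ∀ y, deriv (fun y => cos (π / 2 * y) * g y) y =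
      -sin (π / 2 * y) * (π / 2) * g y + cos (π / 2 * y) * deriv g y :=
    fun y => ((hcd y).mul (hdg y)).deriv
  -- the boundary term
  set W : ℝ → ℝ := fun y => cos (π / 2 * y) * sin (π / 2 * y) * g y ^ 2
  have hWs : ContDiff ℝ 1 W := by
    have : ContDiff ℝ 1 g := hg.of_le (by exact_mod_cast le_top)
    fun_prop
  have hWc : HasCompactSupport W := (strip_cs_sq hc).mul_left
  have hWi : Integrable (deriv W) :=
    (hWs.continuous_deriv (by norm_num)).integrable_of_hasCompactSupport hWc.deriv
  have hW0 : ∫ y, deriv W y = 0 :=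
    integral_eq_zero_of_hasDerivAt_of_integrable
      (fun y => (hWs.differentiable (by norm_num) y).hasDerivAt) hWi
      (hWs.continuous.integrable_of_hasCompactSupport hWc)
  have hWd : ∀ y, deriv W y = (-sin (π / 2 * y) * (π / 2) * sin (π / 2 * y) +
      cos (π / 2 * y) * (cos (π / 2 * y) * (π / 2))) * g y ^ 2 +
      cos (π / 2 * y) * sin (π / 2 * y) * (2 * g y * deriv g y) := by
    intro y
    have : HasDerivAt W _ y := ((hcd y).mul (hsd y)).mul ((hdg y).pow 2)
    rw [this.deriv]; simp
  have hpt : ∀ y, deriv (fun y => cos (π / 2 * y) * g y) y ^ 2 =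
      (π ^ 2 / 4 * (cos (π / 2 * y) * g y) ^ 2 + (cos (π / 2 * y) * deriv g y) ^ 2) -
      π / 2 * deriv W y := by
    intro y
    rw [hpsi, hWd]; ring
  have i1 : Integrable (fun y => (cos (π / 2 * y) * g y) ^ 2) :=
    integrable_sq_of_cs (by have := hg.continuous; fun_prop) hc.mul_left
  have i2 : Integrable (fun y => (cos (π / 2 * y) * deriv g y) ^ 2) :=
    integrable_sq_of_cs (by fun_prop) hc.deriv.mul_left
  simp_rw [hpt]
  have i3 : Integrable (fun y => π ^ 2 / 4 * (cos (π / 2 * y) * g y) ^ 2 +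
      (cos (π / 2 * y) * deriv g y) ^ 2) := (i1.const_mul _).add i2
  rw [integral_sub i3 (hWi.const_mul _), integral_add (i1.const_mul _) i2,
    integral_const_mul, integral_const_mul, hW0]
  ring

theorem psi_error_tendsto : Filter.Tendsto
    (fun n : ℕ => ∫ y, (cos (π / 2 * y) * deriv (stripCut ((n : ℝ) + 1)) y) ^ 2)
    Filter.atTop (nhds 0) := by
  obtain ⟨C, hC0, hC⟩ := deriv_smoothTransition_bdd
  have key : Filter.Tendsto
    (fun n : ℕ => ∫ y, (cos (π / 2 * y) * deriv (stripCut ((n : ℝ) + 1)) y) ^ 2)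
    Filter.atTop (nhds (∫ y : ℝ, (0 : ℝ))) := by
    refine tendsto_integral_of_dominated_convergence
      (Set.indicator (Set.Icc (-1 : ℝ) 1) fun _ => (2 * π * C) ^ 2) ?_ ?_ ?_ ?_
    · intro n
      have := (stripCut_contDiff ((n : ℝ) + 1)).continuous_deriv (by simp)
      exact (by fun_prop : Continuous _).aestronglyMeasurable
    · rw [integrable_indicator_iff measurableSet_Icc]
      exact integrableOn_const (by simp)
    · intro n
      refine Filter.Eventually.of_forall fun y => ?_
      have hN : (0 : ℝ) < (n : ℝ) + 1 := by positivity
      set N : ℝ := (n : ℝ) + 1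
      have hnn : 0 ≤ Set.indicator (Set.Icc (-1 : ℝ) 1) (fun _ => (2 * π * C) ^ 2) y :=
        Set.indicator_nonneg (fun _ _ => by positivity) y
      rw [(stripCut_hasDerivAt N y).deriv]
      by_cases ht : (1 - y ^ 2) * N - 1 < 0 ∨ 1 < (1 - y ^ 2) * N - 1
      · rw [deriv_smoothTransition_zero ht]
        simpa using hnn
      · push Not at ht
        obtain ⟨ht1, ht2⟩ := ht
        have hy2 : y ^ 2 ≤ 1 := by
          by_contra h3
          nlinarith
        have hy : |y| ≤ 1 := (sq_le_one_iff_abs_le_one y).1 hy2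
        rw [Set.indicator_of_mem (show y ∈ Set.Icc (-1 : ℝ) 1 from abs_le.1 hy), Real.norm_eq_abs,
          abs_of_nonneg (sq_nonneg _), ← sq_abs]
        gcongr
        rw [abs_mul, abs_mul, abs_mul, abs_neg, abs_mul, abs_of_pos hN, abs_two]
        calc |cos (π / 2 * y)| * (|deriv smoothTransition ((1 - y ^ 2) * N - 1)| * (2 * |y| * N))
            ≤ (π / 2 * (1 - y ^ 2)) * (C * (2 * 1 * N)) := by
              have := cos_strip_bound hy
              have h3 := hC ((1 - y ^ 2) * N - 1)
              have h4 : 0 ≤ 1 - y ^ 2 := by linarith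
              gcongr
          _ = π * C * ((1 - y ^ 2) * N) := by ring
          _ ≤ π * C * 2 := by
              have : (1 - y ^ 2) * N ≤ 2 := by linarith
              have := Real.pi_pos
              gcongr
          _ = 2 * π * C := by ring
    · refine Filter.Eventually.of_forall fun y => ?_
      apply tendsto_const_nhds.congr'
      by_cases hy : y ^ 2 < 1
      · have hp : 0 < 1 - y ^ 2 := by linarith
        obtain ⟨m, hm⟩ := exists_nat_gt (2 / (1 - y ^ 2))
        filter_upwards [Filter.eventually_ge_atTop m] with n hn
        have hn' : (m : ℝ) ≤ n := by exact_mod_cast hn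
        rw [div_lt_iff₀ hp] at hm
        rw [(stripCut_hasDerivAt _ y).deriv, deriv_smoothTransition_zero]
        · simp
        · right
          nlinarith
      · refine Filter.Eventually.of_forall fun n => ?_
        beta_reduce
        rw [(stripCut_hasDerivAt _ y).deriv, deriv_smoothTransition_zero]
        · simp
        · left
          have : (0 : ℝ) < (n : ℝ) + 1 := by positivity
          push Not at hy
          nlinarith
  simpa using key

theorem exists_psi {ε : ℝ} (hε : 0 < ε) : ∃ ψ : ℝ → ℝ, ContDiff ℝ (⊤ : ℕ∞) ψ ∧
    HasCompactSupport ψ ∧ tsupport ψ ⊆ Set.Ioo (-1) 1 ∧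
    0 < (∫ t, ψ t ^ 2) ∧ (∫ t, deriv ψ t ^ 2) ≤ (π ^ 2 / 4 + ε) * ∫ t, ψ t ^ 2 := by
  have hcont : ∀ N : ℝ, ContDiff ℝ (⊤ : ℕ∞) (fun y => cos (π / 2 * y) * stripCut N y) := by
    intro N
    have := stripCut_contDiff N
    fun_prop
  have hcs : ∀ N : ℝ, 0 < N → HasCompactSupport (fun y => cos (π / 2 * y) * stripCut N y) :=
    fun N hN => (stripCut_cs hN).mul_left
  have hm : 0 < ∫ y, (cos (π / 2 * y) * stripCut 2 y) ^ 2 :=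
    ((hcont 2).continuous.pow 2).integral_pos_of_hasCompactSupport_nonneg_nonzero
      (strip_cs_sq (hcs 2 (by norm_num))) (fun x => by positivity) (x := 0) (by
        have : stripCut 2 0 = 1 := smoothTransition.one_of_one_le (by norm_num)
        simp [this])
  set m := ∫ y, (cos (π / 2 * y) * stripCut 2 y) ^ 2
  have hev := (psi_error_tendsto.eventually (gt_mem_nhds (mul_pos hε hm))).and
    (Filter.eventually_ge_atTop 1)
  obtain ⟨n, hn, hn1⟩ := hev.exists
  have hn1' : (1 : ℝ) ≤ n := by exact_mod_cast hn1
  set N : ℝ := (n : ℝ) + 1 with hNdef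
  have hN2 : 2 ≤ N := by linarith
  have hN : 0 < N := by linarith
  have hmN : m ≤ ∫ y, (cos (π / 2 * y) * stripCut N y) ^ 2 := by
    apply integral_mono
    · exact integrable_sq_of_cs (hcont 2).continuous (hcs 2 (by norm_num))
    · exact integrable_sq_of_cs (hcont N).continuous (hcs N hN)
    · intro y
      simp only [mul_pow]
      have h0 : 0 ≤ stripCut 2 y := smoothTransition.nonneg _
      have : stripCut 2 y ≤ stripCut N y := by
        by_cases hy : y ^ 2 ≤ 1
        · apply smoothTransition.monotone
          have : 0 ≤ 1 - y ^ 2 := by linarith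
          gcongr
        · have : stripCut 2 y = 0 := smoothTransition.zero_of_nonpos (by linarith)
          rw [this]
          exact smoothTransition.nonneg _
      gcongr
  refine ⟨_, hcont N, hcs N hN, ?_, hm.trans_le hmN, ?_⟩
  · exact (closure_mono (Function.support_mul_subset_right _ _)).trans (stripCut_tsupport hN)
  · rw [psi_identity hN]
    have : ε * m ≤ ε * ∫ y, (cos (π / 2 * y) * stripCut N y) ^ 2 := by gcongr
    linarith

/-- The first Poincaré constant of the strip `Ω = ℝ × (-1,1)` equals `π²/4`:
`inf { ∫_Ω |∇u|² / ∫_Ω u² : u ∈ C_c^∞(Ω), u ≢ 0 } = π²/4`. -/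
theorem strip_poincare_constant :
    sInf {r : ℝ | ∃ u : EuclideanSpace ℝ (Fin 2) → ℝ, IsTest strip u ∧ u ≠ 0 ∧
      r = (∫ x in strip, ‖fderiv ℝ u x‖ ^ 2) / ∫ x in strip, u x ^ 2} =
      Real.pi ^ 2 / 4 := by
  have hex : ∀ ε : ℝ, 0 < ε → ∃ r ∈ {r : ℝ | ∃ u : EuclideanSpace ℝ (Fin 2) → ℝ,
      IsTest strip u ∧ u ≠ 0 ∧
      r = (∫ x in strip, ‖fderiv ℝ u x‖ ^ 2) / ∫ x in strip, u x ^ 2},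
      r ≤ Real.pi ^ 2 / 4 + 2 * ε := by
    intro ε hε
    obtain ⟨φ, p1, p2, p3, p4⟩ := exists_phi hε
    obtain ⟨ψ, q1, q2, q3, q4, q5⟩ := exists_psi hε
    obtain ⟨ht, hd, hnum⟩ := strip_product p1 p2 q1 q2 q3
    refine ⟨_, ⟨_, ht, ?_, rfl⟩, ?_⟩
    · intro h
      have hz : ∀ x : EuclideanSpace ℝ (Fin 2), φ (x 0) * ψ (x 1) = 0 := fun x => congrFun h x
      simp_rw [hz] at hd
      have := mul_pos p3 q4
      rw [← hd] at this
      simp at this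
    · obtain ⟨e1, e2⟩ := strip_setIntegrals ht
      rw [e1, e2, hd, hnum, div_le_iff₀ (mul_pos p3 q4)]
      nlinarith [mul_le_mul_of_nonneg_right p4 q4.le, mul_le_mul_of_nonneg_left q5 p3.le]
  apply le_antisymm
  · apply le_of_forall_pos_le_add
    intro ε hε
    obtain ⟨r, hr, hle⟩ := hex (ε / 2) (by positivity)
    refine (csInf_le ⟨0, ?_⟩ hr).trans (by linarith)
    rintro _ ⟨u, -, -, rfl⟩
    apply div_nonneg <;> exact integral_nonneg fun x => by positivity
  · apply le_csInf
    · obtain ⟨r, hr, -⟩ := hex 1 one_pos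
      exact ⟨r, hr⟩
    · rintro _ ⟨u, hu, h0, rfl⟩
      obtain ⟨e1, e2⟩ := strip_setIntegrals hu
      rw [e1, e2, le_div_iff₀ (strip_den_pos hu h0)]
      exact strip_lower hu
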